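/- Let (A, {Δ(λ)}_{λ∈Λ}) be a split quasi-hereditary algebra over a commutative Noetherian ring R, (A, P, V) an RQF3 R-algebra, and T a characteristic tilting module of A. Then domdim_{(A,R)} T = inf{ domdim_{(A,R)} Δ(λ) : λ ∈ Λ } = inf{ domdim_{(A,R)} M : M ∈ 𝓕(Δ̃) }, where 𝓕(Δ̃) is the category of A-modules with a finite filtration by direct summands of modules Δ(λ) ⊗_R U with U ∈ R-proj. -/

import Mathlib

open Function

section Basics

/-- A predicate on left `A`-modules, describing a full subcategory of `A`-mod. -/
def ModPred (A : Type) [Ring A] : Type 1 :=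
  (M : Type) → [AddCommGroup M] → [Module A M] → Prop

/-- `T` is a direct summand of `W` (as `A`-modules). -/
def IsSummandOf (A : Type) [Ring A] (T W : Type) [AddCommGroup T] [Module A T]
    [AddCommGroup W] [Module A W] : Prop :=
  ∃ (i : T →ₗ[A] W) (r : W →ₗ[A] T), r.comp i = LinearMap.id

/-- `M` has a finite filtration whose subquotients lie in `Θ`. -/
inductive HasFilt (A : Type) [Ring A] (Θ : ModPred A) :
    (M : Type) → [AddCommGroup M] → [Module A M] → Prop
  | of_subsingleton (M : Type) [AddCommGroup M] [Module A M] :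
      Subsingleton M → HasFilt A Θ M
  | step (K M Q : Type) [AddCommGroup K] [Module A K] [AddCommGroup M] [Module A M]
      [AddCommGroup Q] [Module A Q] (i : K →ₗ[A] M) (p : M →ₗ[A] Q)
      (hi : Function.Injective i) (hp : Function.Surjective p)
      (hex : Function.Exact i p) (hQ : Θ Q) (hK : HasFilt A Θ K) : HasFilt A Θ M

end Basics

section RelativeInjectives

variable (R : Type) [CommRing R] (A : Type) [Ring A] [Algebra R A]

/-- The dual `D A = Hom_R(A, R)` is a left `A`-module via `(a • f) x = f (x * a)`. -/
noncomputable instance dualModule : Module A (A →ₗ[R] R) where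
  smul a f := f.comp (LinearMap.mulRight R a)
  one_smul f := LinearMap.ext fun x => by
    show f ((LinearMap.mulRight R (1 : A)) x) = f x
    rw [LinearMap.mulRight_apply, mul_one]
  mul_smul a b f := LinearMap.ext fun x => by
    show f ((LinearMap.mulRight R (a * b)) x)
      = f ((LinearMap.mulRight R b) ((LinearMap.mulRight R a) x))
    simp only [LinearMap.mulRight_apply, mul_assoc]
  smul_zero a := rfl
  smul_add a f g := rfl
  add_smul a b f := LinearMap.ext fun x => by
    show f ((LinearMap.mulRight R (a + b)) x)
      = f ((LinearMap.mulRight R a) x) + f ((LinearMap.mulRight R b) x)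
    simp only [LinearMap.mulRight_apply, mul_add, map_add]
  zero_smul f := LinearMap.ext fun x => by
    show f ((LinearMap.mulRight R (0 : A)) x) = 0
    simp only [LinearMap.mulRight_apply, mul_zero, map_zero]

/-- `M` is `(A, R)`-injective: it is a direct summand of a finite direct sum of copies of
`D A = Hom_R(A, R)`. -/
noncomputable def IsRelInjective (M : Type) [AddCommGroup M] [Module A M] : Prop :=
  ∃ n : ℕ, IsSummandOf A M (Fin n → (A →ₗ[R] R))

/-- A map is `R`-split (von Neumann regular over `R`): it admits an `R`-linear
quasi-inverse.  An exact sequence of `A`-modules is `(A, R)`-exact precisely when all its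
maps have this property. -/
def IsRSplit {X Y : Type} [AddCommGroup X] [AddCommGroup Y] [Module R X] [Module R Y]
    (f : X → Y) : Prop :=
  ∃ h : Y →ₗ[R] X, ∀ x, f (h (f x)) = f x

/-- A witness that `domdim_{(A,R)} M ≥ t`:  an `(A, R)`-exact sequence
`0 → M → I_1 → ⋯ → I_t` (`I_i = X (i-1)`) with all `I_i` projective and
`(A, R)`-injective. -/
structure RelCoresolution (t : ℕ) (M : Type) [AddCommGroup M] [Module A M]
    [Module R M] [IsScalarTower R A M] : Type 1 where
  X : ℕ → Type
  [grp : ∀ i, AddCommGroup (X i)]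
  [modA : ∀ i, Module A (X i)]
  [modR : ∀ i, Module R (X i)]
  [tower : ∀ i, IsScalarTower R A (X i)]
  projinj : ∀ i, i + 1 ≤ t →
    Module.Finite A (X i) ∧ Module.Projective A (X i) ∧ IsRelInjective R A (X i)
  f : M →ₗ[A] X 0
  d : ∀ i, X i →ₗ[A] X (i + 1)
  hf : 1 ≤ t → Function.Injective f
  hfsplit : 1 ≤ t → IsRSplit R ⇑f
  hexact0 : 2 ≤ t → Function.Exact f (d 0)
  hexact : ∀ i, i + 3 ≤ t → Function.Exact (d i) (d (i + 1))
  hdsplit : ∀ i, i + 2 ≤ t → IsRSplit R ⇑(d i)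

attribute [instance] RelCoresolution.grp RelCoresolution.modA RelCoresolution.modR
  RelCoresolution.tower

/-- The relative dominant dimension of `M` over `(A, R)` is at least `t`. -/
def RelDomDimGE (t : ℕ) (M : Type) [AddCommGroup M] [Module A M]
    [Module R M] [IsScalarTower R A M] : Prop :=
  Nonempty (RelCoresolution R A t M)

/-- `P` is `(A, R)`-strongly faithful: there is an `(A, R)`-monomorphism `A ↪ P^t`. -/
def IsRelStronglyFaithful (P : Type) [AddCommGroup P] [Module A P] [Module R P]
    [IsScalarTower R A P] : Prop :=
  ∃ (t : ℕ) (i : A →ₗ[A] (Fin t → P)), Function.Injective i ∧ IsRSplit R ⇑i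

end RelativeInjectives

section QuasiHereditary

/-- A split quasi-hereditary structure on the `R`-algebra `A`, with weight poset `Λ` and
standard modules `Δ λ`:
(i) the `Δ(λ)` are (finitely generated) projective over `R`;
(ii) `Hom_A(Δ(λ), Δ(μ)) ≠ 0` implies `λ ≤ μ`;
(iii) `End_A(Δ(λ)) ≅ R`;
(iv) each `Δ(λ)` is covered by a finitely generated projective `P(λ)` whose kernel is
filtered by modules `Δ(μ) ⊗ U` (`U ∈ R`-proj, `μ > λ`), realised here as direct summands
of finite direct sums of copies of `Δ(μ)`, `μ > λ`;
(v) `⨁ P(λ)` is a progenerator. -/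
structure SplitQH (R : Type) [CommRing R] (A : Type) [Ring A] [Algebra R A] : Type 1 where
  Λ : Type
  [po : PartialOrder Λ]
  [fintypeΛ : Fintype Λ]
  Δ : Λ → Type
  [grp : ∀ l, AddCommGroup (Δ l)]
  [mod : ∀ l, Module A (Δ l)]
  [modR : ∀ l, Module R (Δ l)]
  [tower : ∀ l, IsScalarTower R A (Δ l)]
  [scc : ∀ l, SMulCommClass A R (Δ l)]
  fin : ∀ l, Module.Finite A (Δ l)
  rproj : ∀ l, Module.Finite R (Δ l) ∧ Module.Projective R (Δ l)
  hom_le : ∀ l m, (∃ φ : Δ l →ₗ[A] Δ m, φ ≠ 0) → l ≤ m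
  endo : ∀ (l : Λ) (φ : Δ l →ₗ[A] Δ l), ∃ c : R, φ = c • (LinearMap.id : Δ l →ₗ[A] Δ l)
  Pr : Λ → Type
  [pgrp : ∀ l, AddCommGroup (Pr l)]
  [pmod : ∀ l, Module A (Pr l)]
  pfin : ∀ l, Module.Finite A (Pr l)
  pproj : ∀ l, Module.Projective A (Pr l)
  π : ∀ l, Pr l →ₗ[A] Δ l
  hπ : ∀ l, Function.Surjective (π l)
  kernel_filtered : ∀ l, ∃ (C : ModuleCat A) (ι : C →ₗ[A] Pr l),
    Function.Injective ι ∧ Function.Exact ι (π l) ∧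
      HasFilt A (fun T [AddCommGroup T] [Module A T] =>
        ∃ m, l < m ∧ ∃ n : ℕ, IsSummandOf A T (Fin n → Δ m)) C
  progen : ∃ n : ℕ, IsSummandOf A A (Fin n → ∀ l, Pr l)

attribute [instance] SplitQH.po SplitQH.fintypeΛ SplitQH.grp SplitQH.mod SplitQH.modR
  SplitQH.tower SplitQH.scc SplitQH.pgrp SplitQH.pmod

end QuasiHereditary

/-- The subquotient class of `𝓕(Δ̃)`: direct summands of finite direct sums of standard
modules (equivalently, the modules `Δ(λ) ⊗_R U` with `U ∈ R`-proj, since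
`End_A(Δ(λ)) ≅ R`). -/
def stdClass (R : Type) [CommRing R] (A : Type) [Ring A] [Algebra R A]
    (Q : SplitQH R A) : ModPred A :=
  fun T [AddCommGroup T] [Module A T] =>
    ∃ (l : Q.Λ) (n : ℕ), IsSummandOf A T (Fin n → Q.Δ l)

section RelativeExactSequences

variable (R : Type) [CommRing R] {A : Type} [Ring A] [Algebra R A]

/-- The sequence `0 → X → Y → Z → 0` of `A`-modules is exact and split over `R`. -/
def IsRelSES {X Y Z : Type} [AddCommGroup X] [Module A X] [Module R X]
    [AddCommGroup Y] [Module A Y] [Module R Y] [AddCommGroup Z] [Module A Z] [Module R Z]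
    (i : X →ₗ[A] Y) (p : Y →ₗ[A] Z) : Prop :=
  ∃ (ρ : Y →ₗ[R] X) (σ : Z →ₗ[R] Y), (∀ x, ρ (i x) = x) ∧ (∀ z, p (σ z) = z) ∧
    (∀ x, p (i x) = 0) ∧ ∀ y, i (ρ y) + σ (p y) = y

/-- An `R`-linear map out of an `A`-module descends to the quotient by an `A`-submodule on
which it vanishes. -/
def quotLift {X Y : Type} [AddCommGroup X] [Module A X] [Module R X] [IsScalarTower R A X]
    [AddCommGroup Y] [Module R Y] (N : Submodule A X) (g : X →ₗ[R] Y)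
    (h : ∀ x ∈ N, g x = 0) : (X ⧸ N) →ₗ[R] Y :=
  ((N.restrictScalars R).liftQ g h).comp
    (Submodule.Quotient.restrictScalarsEquiv R N).symm.toLinearMap

@[simp]
lemma quotLift_mk {X Y : Type} [AddCommGroup X] [Module A X] [Module R X]
    [IsScalarTower R A X] [AddCommGroup Y] [Module R Y] (N : Submodule A X) (g : X →ₗ[R] Y)
    (h : ∀ x ∈ N, g x = 0) (x : X) :
    quotLift R N g h (Submodule.Quotient.mk x) = g x := rfl

variable {X Y Z : Type} [AddCommGroup X] [Module A X] [Module R X] [IsScalarTower R A X]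
  [AddCommGroup Y] [Module A Y] [Module R Y] [IsScalarTower R A Y]
  [AddCommGroup Z] [Module A Z] [Module R Z] [IsScalarTower R A Z]

variable {R} in
lemma isRelSES_of_retraction (f : X →ₗ[A] Y) (s : Y →ₗ[R] X) (hs : ∀ x, s (f x) = x) :
    IsRelSES R f (LinearMap.range f).mkQ := by
  refine ⟨s, quotLift R _ (LinearMap.id - (f.restrictScalars R).comp s) ?_, hs, ?_, ?_, ?_⟩
  · rintro _ ⟨x, rfl⟩
    simp [hs]
  · intro z
    obtain ⟨y, rfl⟩ := Submodule.Quotient.mk_surjective _ z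
    simp
  · intro x
    simp
  · intro y
    simp

lemma isRelSES_of_section (i : X →ₗ[A] Y) (p : Y →ₗ[A] Z) (hi : Injective i)
    (hex : Exact i p) (σ : Z →ₗ[R] Y) (hσ : ∀ z, p (σ z) = z) : IsRelSES R i p := by
  have hmem : ∀ y, ∃ x, i x = y - σ (p y) := fun y =>
    (hex _).1 (by rw [map_sub, hσ, sub_self])
  choose ρ hρ using hmem
  refine ⟨{ toFun := ρ, map_add' := fun a b => hi ?_, map_smul' := fun r a => hi ?_ }, σ,
    fun x => hi ?_, hσ, hex.apply_apply_eq_zero, fun y => ?_⟩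
  · simp only [map_add, hρ]
    abel
  · rw [RingHom.id_apply, LinearMap.map_smul_of_tower, hρ, hρ, LinearMap.map_smul_of_tower,
      map_smul, smul_sub]
  · simp [hρ, hex.apply_apply_eq_zero]
  · simp [hρ]

end RelativeExactSequences

section RelativeInjectiveModules

variable {R : Type} [CommRing R] {A : Type} [Ring A] [Algebra R A]

lemma dualModule_smul_apply (a : A) (f : A →ₗ[R] R) (x : A) : (a • f) x = f (x * a) := rfl

/-- The `A`-linear map `X → D A` attached to an `R`-linear functional on `X`. -/
noncomputable def coextend {X : Type} [AddCommGroup X] [Module A X] [Module R X]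
    [IsScalarTower R A X] (φ : X →ₗ[R] R) : X →ₗ[A] (A →ₗ[R] R) where
  toFun x := φ.comp ((LinearMap.toSpanSingleton A X x).restrictScalars R)
  map_add' x y := by ext a; simp
  map_smul' b x := by
    ext a
    simp [dualModule_smul_apply, mul_smul]

lemma coextend_apply {X : Type} [AddCommGroup X] [Module A X] [Module R X]
    [IsScalarTower R A X] (φ : X →ₗ[R] R) (x : X) (a : A) :
    coextend φ x a = φ (a • x) := rfl

lemma IsRelInjective.exists_extension {I X Y : Type} [AddCommGroup I] [Module A I]
    [AddCommGroup X] [Module A X] [Module R X] [IsScalarTower R A X]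
    [AddCommGroup Y] [Module A Y] [Module R Y] [IsScalarTower R A Y]
    (hI : IsRelInjective R A I) (i : X →ₗ[A] Y) (ρ : Y →ₗ[R] X) (hρ : ∀ x, ρ (i x) = x)
    (f : X →ₗ[A] I) : ∃ g : Y →ₗ[A] I, ∀ x, g (i x) = f x := by
  obtain ⟨n, j, r, hrj⟩ := hI
  let φ (k : Fin n) : X →ₗ[R] R :=
    { toFun := fun x => j (f x) k 1
      map_add' := by simp
      map_smul' := fun c x => by
        rw [← algebraMap_smul A c x, map_smul, map_smul, Pi.smul_apply, dualModule_smul_apply,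
          one_mul, Algebra.algebraMap_eq_smul_one, map_smul, RingHom.id_apply] }
  refine ⟨r.comp (LinearMap.pi fun k => coextend ((φ k).comp ρ)), fun x => ?_⟩
  have hx : (LinearMap.pi fun k => coextend ((φ k).comp ρ)) (i x) = j (f x) := by
    ext k a
    rw [LinearMap.pi_apply, coextend_apply, ← map_smul, LinearMap.comp_apply, hρ]
    change j (f (a • x)) k 1 = _
    rw [map_smul, map_smul, Pi.smul_apply, dualModule_smul_apply, one_mul]
  rw [LinearMap.comp_apply, hx]
  exact LinearMap.congr_fun hrj _

lemma IsRelInjective.prod {I J : Type} [AddCommGroup I] [Module A I] [AddCommGroup J]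
    [Module A J] (hI : IsRelInjective R A I) (hJ : IsRelInjective R A J) :
    IsRelInjective R A (I × J) := by
  obtain ⟨m, i, r, hi⟩ := hI
  obtain ⟨n, j, s, hj⟩ := hJ
  let e : ((Fin m → (A →ₗ[R] R)) × (Fin n → (A →ₗ[R] R))) ≃ₗ[A]
      (Fin (m + n) → (A →ₗ[R] R)) :=
    (LinearEquiv.sumArrowLequivProdArrow (Fin m) (Fin n) A (A →ₗ[R] R)).symm.trans
      (LinearEquiv.funCongrLeft A (A →ₗ[R] R) finSumFinEquiv.symm)
  refine ⟨m + n, e.toLinearMap.comp (i.prodMap j), (r.prodMap s).comp e.symm.toLinearMap, ?_⟩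
  refine LinearMap.ext fun x => Prod.ext ?_ ?_
  · simpa using LinearMap.congr_fun hi x.1
  · simpa using LinearMap.congr_fun hj x.2

lemma isRelInjective_of_subsingleton (I : Type) [AddCommGroup I] [Module A I]
    [Subsingleton I] : IsRelInjective R A I :=
  ⟨0, 0, 0, LinearMap.ext fun _ => Subsingleton.elim _ _⟩

end RelativeInjectiveModules

section RelativeDominantDimension

variable {R : Type} [CommRing R] {A : Type} [Ring A] [Algebra R A]

/-- Splicing an `(A, R)`-exact sequence `0 → M → I → C → 0` with a coresolution of `C`. -/
def RelCoresolution.splice {t : ℕ} {M I C : Type} [AddCommGroup M] [Module A M] [Module R M]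
    [IsScalarTower R A M] [AddCommGroup I] [Module A I] [Module R I] [IsScalarTower R A I]
    [AddCommGroup C] [Module A C] [Module R C] [IsScalarTower R A C]
    (hI : Module.Finite A I ∧ Module.Projective A I ∧ IsRelInjective R A I)
    (f : M →ₗ[A] I) (p : I →ₗ[A] C) (h : IsRelSES R f p) (c : RelCoresolution R A t C) :
    RelCoresolution R A (t + 1) M where
  X n := match n with
    | 0 => I
    | n + 1 => c.X n
  grp n := match n with
    | 0 => inferInstanceAs (AddCommGroup I)
    | n + 1 => c.grp n
  modA n := match n with
    | 0 => inferInstanceAs (Module A I)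
    | n + 1 => c.modA n
  modR n := match n with
    | 0 => inferInstanceAs (Module R I)
    | n + 1 => c.modR n
  tower n := match n with
    | 0 => inferInstanceAs (IsScalarTower R A I)
    | n + 1 => c.tower n
  projinj n := match n with
    | 0 => fun _ => hI
    | n + 1 => fun hn => c.projinj n (by omega)
  f := f
  d n := match n with
    | 0 => c.f.comp p
    | n + 1 => c.d n
  hf _ := by
    obtain ⟨ρ, -, hρ, -⟩ := h
    exact LeftInverse.injective hρ
  hfsplit _ := by
    obtain ⟨ρ, -, hρ, -⟩ := h
    exact ⟨ρ, fun x => congrArg f (hρ x)⟩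
  hexact0 ht := by
    obtain ⟨ρ, σ, hρ, hσ, h0, hsum⟩ := h
    intro x
    constructor
    · intro hx
      have hpx : p x = 0 := c.hf (by omega) (hx.trans (map_zero c.f).symm)
      exact ⟨ρ x, by simpa [hpx] using hsum x⟩
    · rintro ⟨y, rfl⟩
      exact (congrArg c.f (h0 y)).trans (map_zero c.f)
  hexact n := match n with
    | 0 => fun hn => by
      obtain ⟨ρ, σ, hρ, hσ, h0, hsum⟩ := h
      intro x
      refine (c.hexact0 (by omega) x).trans ⟨?_, ?_⟩
      · rintro ⟨y, rfl⟩
        exact ⟨σ y, congrArg c.f (hσ y)⟩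
      · rintro ⟨y, rfl⟩
        exact ⟨p y, rfl⟩
    | n + 1 => fun hn => c.hexact n (by omega)
  hdsplit n := match n with
    | 0 => fun hn => by
      obtain ⟨ρ, σ, hρ, hσ, h0, hsum⟩ := h
      obtain ⟨s, hs⟩ := c.hfsplit (by omega)
      exact ⟨σ.comp s, fun x => (congrArg c.f (hσ _)).trans (hs (p x))⟩
    | n + 1 => fun hn => c.hdsplit n (by omega)

/-- The cokernel of the first map of a coresolution inherits a coresolution, one step
shorter. -/
noncomputable def RelCoresolution.cokernel {t : ℕ} {M : Type} [AddCommGroup M] [Module A M]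
    [Module R M] [IsScalarTower R A M] (c : RelCoresolution R A (t + 1 + 1) M) :
    RelCoresolution R A (t + 1) (c.X 0 ⧸ LinearMap.range c.f) where
  X n := c.X (n + 1)
  projinj n hn := c.projinj (n + 1) (by omega)
  f := (LinearMap.range c.f).liftQ (c.d 0) (by
    rintro _ ⟨y, rfl⟩
    exact (c.hexact0 (by omega)).apply_apply_eq_zero y)
  d n := c.d (n + 1)
  hf _ := by
    rw [← LinearMap.ker_eq_bot, Submodule.ker_liftQ_eq_bot]
    intro x hx
    exact (c.hexact0 (by omega) x).1 hx
  hfsplit _ := by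
    obtain ⟨h, hh⟩ := c.hdsplit 0 (by omega)
    refine ⟨((LinearMap.range c.f).mkQ.restrictScalars R).comp h, fun x => ?_⟩
    obtain ⟨y, rfl⟩ := Submodule.Quotient.mk_surjective _ x
    exact hh y
  hexact0 ht := by
    intro x
    refine (c.hexact 0 (by omega) x).trans ⟨?_, ?_⟩
    · rintro ⟨y, rfl⟩
      exact ⟨Submodule.Quotient.mk y, rfl⟩
    · rintro ⟨y, rfl⟩
      obtain ⟨y, rfl⟩ := Submodule.Quotient.mk_surjective _ y
      exact ⟨y, rfl⟩
  hexact n hn := c.hexact (n + 1) (by omega)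
  hdsplit n hn := c.hdsplit (n + 1) (by omega)

lemma relDomDimGE_zero (M : Type) [AddCommGroup M] [Module A M] [Module R M]
    [IsScalarTower R A M] : RelDomDimGE R A 0 M :=
  ⟨{  X := fun _ => PUnit
      projinj := fun _ h => by omega
      f := 0
      d := fun _ => 0
      hf := fun h => by omega
      hfsplit := fun h => by omega
      hexact0 := fun h => by omega
      hexact := fun _ h => by omega
      hdsplit := fun _ h => by omega }⟩

lemma RelDomDimGE.of_succ {t : ℕ} {M : Type} [AddCommGroup M] [Module A M] [Module R M]
    [IsScalarTower R A M] (h : RelDomDimGE R A (t + 1) M) : RelDomDimGE R A t M := by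
  obtain ⟨c⟩ := h
  exact ⟨{
    X := c.X
    projinj := fun i hi => c.projinj i (by omega)
    f := c.f
    d := c.d
    hf := fun _ => c.hf (by omega)
    hfsplit := fun _ => c.hfsplit (by omega)
    hexact0 := fun _ => c.hexact0 (by omega)
    hexact := fun i hi => c.hexact i (by omega)
    hdsplit := fun i hi => c.hdsplit i (by omega) }⟩

lemma RelDomDimGE.succ {t : ℕ} {M I C : Type} [AddCommGroup M] [Module A M] [Module R M]
    [IsScalarTower R A M] [AddCommGroup I] [Module A I] [Module R I] [IsScalarTower R A I]
    [AddCommGroup C] [Module A C] [Module R C] [IsScalarTower R A C]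
    (hI : Module.Finite A I ∧ Module.Projective A I ∧ IsRelInjective R A I)
    (f : M →ₗ[A] I) (p : I →ₗ[A] C) (h : IsRelSES R f p) (hC : RelDomDimGE R A t C) :
    RelDomDimGE R A (t + 1) M :=
  ⟨.splice hI f p h hC.some⟩

lemma RelDomDimGE.exists_embedding {t : ℕ} {M : Type} [AddCommGroup M] [Module A M]
    [Module R M] [IsScalarTower R A M] (h : RelDomDimGE R A (t + 1) M) :
    ∃ (I : Type) (_ : AddCommGroup I) (_ : Module A I) (_ : Module R I)
      (_ : IsScalarTower R A I) (f : M →ₗ[A] I) (s : I →ₗ[R] M),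
      (Module.Finite A I ∧ Module.Projective A I ∧ IsRelInjective R A I) ∧
        (∀ x, s (f x) = x) ∧ RelDomDimGE R A t (I ⧸ LinearMap.range f) := by
  obtain ⟨c⟩ := h
  obtain ⟨s, hs⟩ := c.hfsplit (by omega)
  refine ⟨c.X 0, inferInstance, inferInstance, inferInstance, inferInstance, c.f, s,
    c.projinj 0 (by omega), fun x => c.hf (by omega) (hs x), ?_⟩
  cases t with
  | zero => exact relDomDimGE_zero _
  | succ t => exact ⟨c.cokernel⟩

lemma relDomDimGE_of_subsingleton (t : ℕ) (M : Type) [AddCommGroup M] [Module A M]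
    [Module R M] [IsScalarTower R A M] [Subsingleton M] : RelDomDimGE R A t M := by
  induction t with
  | zero => exact relDomDimGE_zero M
  | succ t ih =>
    exact .succ ⟨inferInstance, inferInstance, isRelInjective_of_subsingleton M⟩
      (LinearMap.id : M →ₗ[A] M) (0 : M →ₗ[A] M)
      ⟨0, 0, fun _ => Subsingleton.elim _ _, fun _ => Subsingleton.elim _ _,
        fun _ => Subsingleton.elim _ _, fun _ => Subsingleton.elim _ _⟩ ih

/-- The relative dominant dimension of an extension is at least the minimum of those of its
ends. -/
lemma RelDomDimGE.of_extension {t : ℕ} :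
    ∀ {X Y Z : Type} [AddCommGroup X] [Module A X] [Module R X] [IsScalarTower R A X]
      [AddCommGroup Y] [Module A Y] [Module R Y] [IsScalarTower R A Y]
      [AddCommGroup Z] [Module A Z] [Module R Z] [IsScalarTower R A Z]
      (i : X →ₗ[A] Y) (p : Y →ₗ[A] Z), IsRelSES R i p →
      RelDomDimGE R A t X → RelDomDimGE R A t Z → RelDomDimGE R A t Y := by
  induction t with
  | zero => exact fun _ _ _ _ _ => relDomDimGE_zero _
  | succ t ih =>
    intro X Y Z _ _ _ _ _ _ _ _ _ _ _ _ i p h hX hZ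
    obtain ⟨ρ, σ, hρ, hσ, h0, hsum⟩ := h
    obtain ⟨I, _, _, _, _, f, s, hI, hs, hC⟩ := hX.exists_embedding
    obtain ⟨J, _, _, _, _, f', s', hJ, hs', hC'⟩ := hZ.exists_embedding
    obtain ⟨g, hg⟩ := hI.2.2.exists_extension i ρ hρ f
    have := hI.1
    have := hJ.1
    have := hI.2.1
    have := hJ.2.1
    have hgy : ∀ y, g y - g (σ (p y)) = f (ρ y) := fun y => by
      rw [← hg, ← map_sub]
      exact congrArg g (sub_eq_of_eq_add (hsum y).symm)
    let F : Y →ₗ[A] I × J := g.prod (f'.comp p)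
    let δ : I × J →ₗ[R] I :=
      LinearMap.fst R I J -
        ((g.restrictScalars R).comp (σ.comp s')).comp (LinearMap.snd R I J)
    have hδ : ∀ a b, δ (a, b) = a - g (σ (s' b)) := fun a b => rfl
    have hδF : ∀ y, δ (F y) = f (ρ y) := fun y => by
      rw [← hgy]
      change g y - g (σ (s' (f' (p y)))) = _
      rw [hs']
    let S : I × J →ₗ[R] Y :=
      (i.restrictScalars R).comp (s.comp δ) + (σ.comp s').comp (LinearMap.snd R I J)
    have hS : ∀ y, S (F y) = y := fun y => by
      change i (s (δ (F y))) + σ (s' (f' (p y))) = y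
      rw [hδF, hs, hs', hsum]
    refine .succ ⟨inferInstance, inferInstance, hI.2.2.prod hJ.2.2⟩ F
      (LinearMap.range F).mkQ (isRelSES_of_retraction F S hS) ?_
    refine ih
      (Submodule.mapQ (LinearMap.range f) (LinearMap.range F) (LinearMap.inl A I J) ?_)
      (Submodule.mapQ (LinearMap.range F) (LinearMap.range f') (LinearMap.snd A I J) ?_)
      ⟨quotLift R _ (((LinearMap.range f).mkQ.restrictScalars R).comp δ) ?_,
        quotLift R _ (((LinearMap.range F).mkQ.restrictScalars R).comp
          ((LinearMap.inr R I J).comp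
            (LinearMap.id - (f'.restrictScalars R).comp s'))) ?_, ?_, ?_, ?_, ?_⟩ hC hC'
    · rintro _ ⟨x, rfl⟩
      exact ⟨i x, by simp [F, hg, h0]⟩
    · rintro _ ⟨y, rfl⟩
      exact ⟨p y, rfl⟩
    · rintro _ ⟨y, rfl⟩
      simp [hδF]
    · rintro _ ⟨z, rfl⟩
      simpa [hs'] using ⟨0, map_zero F⟩
    · intro x
      obtain ⟨a, rfl⟩ := Submodule.Quotient.mk_surjective _ x
      simp [hδ]
    · intro z
      obtain ⟨b, rfl⟩ := Submodule.Quotient.mk_surjective _ z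
      simp
    · intro x
      obtain ⟨a, rfl⟩ := Submodule.Quotient.mk_surjective _ x
      simp
    · intro y
      obtain ⟨⟨a, b⟩, rfl⟩ := Submodule.Quotient.mk_surjective _ y
      simp only [Submodule.mapQ_apply, quotLift_mk, LinearMap.comp_apply,
        LinearMap.restrictScalars_apply, Submodule.mkQ_apply, hδ]
      rw [← Submodule.Quotient.mk_add, Submodule.Quotient.eq]
      refine ⟨-σ (s' b), ?_⟩
      ext <;> simp [F, hσ]

/-- The relative dominant dimension of a kernel. -/
lemma RelDomDimGE.of_kernel {t : ℕ} {X Y Z : Type} [AddCommGroup X] [Module A X] [Module R X]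
    [IsScalarTower R A X] [AddCommGroup Y] [Module A Y] [Module R Y] [IsScalarTower R A Y]
    [AddCommGroup Z] [Module A Z] [Module R Z] [IsScalarTower R A Z]
    (i : X →ₗ[A] Y) (p : Y →ₗ[A] Z) (h : IsRelSES R i p)
    (hY : RelDomDimGE R A (t + 1) Y) (hZ : RelDomDimGE R A t Z) :
    RelDomDimGE R A (t + 1) X := by
  obtain ⟨ρ, σ, hρ, hσ, h0, hsum⟩ := h
  obtain ⟨I, _, _, _, _, f, s, hI, hs, hC⟩ := hY.exists_embedding
  let F : X →ₗ[A] I := f.comp i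
  refine .succ hI F (LinearMap.range F).mkQ
    (isRelSES_of_retraction F (ρ.comp s) fun x => by simp [F, hs, hρ]) ?_
  let j : Z →ₗ[A] I ⧸ LinearMap.range F :=
    { toFun := fun z => Submodule.Quotient.mk (f (σ z))
      map_add' := fun a b => by simp
      map_smul' := fun a z => by
        rw [RingHom.id_apply, ← Submodule.Quotient.mk_smul, Submodule.Quotient.eq]
        refine ⟨-ρ (a • σ z), ?_⟩
        have h := hsum (a • σ z)
        rw [map_smul p, hσ] at h
        rw [← map_smul f, ← map_sub f]
        refine congrArg f ?_
        rw [map_neg, eq_sub_of_add_eq h, neg_sub] }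
  have hj : ∀ z, j z = Submodule.Quotient.mk (f (σ z)) := fun z => rfl
  refine RelDomDimGE.of_extension j
    (Submodule.mapQ (LinearMap.range F) (LinearMap.range f) LinearMap.id ?_)
    ⟨quotLift R _ ((p.restrictScalars R).comp s) ?_,
      quotLift R _ (((LinearMap.range F).mkQ.restrictScalars R).comp
        (LinearMap.id - (f.restrictScalars R).comp s)) ?_, ?_, ?_, ?_, ?_⟩ hZ hC
  · rintro _ ⟨x, rfl⟩
    exact ⟨i x, rfl⟩
  · rintro _ ⟨x, rfl⟩
    simp [F, hs, h0]
  · rintro _ ⟨y, rfl⟩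
    simp [hs]
  · intro z
    simp [hj, hs, hσ]
  · intro w
    obtain ⟨b, rfl⟩ := Submodule.Quotient.mk_surjective _ w
    simp
  · intro z
    simp [hj]
  · intro w
    obtain ⟨b, rfl⟩ := Submodule.Quotient.mk_surjective _ w
    simp only [hj, Submodule.mapQ_apply, quotLift_mk, LinearMap.comp_apply,
      LinearMap.restrictScalars_apply, Submodule.mkQ_apply]
    rw [← Submodule.Quotient.mk_add, Submodule.Quotient.eq]
    refine ⟨-ρ (s b), ?_⟩
    have := congrArg f (hsum (s b))
    rw [map_add] at this
    simp only [F, LinearMap.comp_apply, map_neg, LinearMap.id_apply, LinearMap.sub_apply,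
      LinearMap.restrictScalars_apply]
    rw [← this]
    abel

lemma RelDomDimGE.of_isSummandOf {t : ℕ} :
    ∀ {M W : Type} [AddCommGroup M] [Module A M] [Module R M] [IsScalarTower R A M]
      [AddCommGroup W] [Module A W] [Module R W] [IsScalarTower R A W],
      IsSummandOf A M W → RelDomDimGE R A t W → RelDomDimGE R A t M := by
  induction t with
  | zero => exact fun _ _ => relDomDimGE_zero _
  | succ t ih =>
    intro M W _ _ _ _ _ _ _ _ hM hW
    obtain ⟨i, r, hri⟩ := hM
    have hri' : ∀ x, r (i x) = x := LinearMap.congr_fun hri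
    refine .of_kernel i _ (isRelSES_of_retraction i (r.restrictScalars R) hri') hW (ih
      (W := W) ⟨(LinearMap.range i).liftQ (LinearMap.id - i.comp r) ?_,
        (LinearMap.range i).mkQ, ?_⟩ ?_)
    · rintro _ ⟨x, rfl⟩
      simp [hri']
    · refine LinearMap.ext fun z => ?_
      obtain ⟨y, rfl⟩ := Submodule.Quotient.mk_surjective _ z
      simp
    · exact hW.of_succ

lemma RelDomDimGE.prod {t : ℕ} {M N : Type} [AddCommGroup M] [Module A M] [Module R M]
    [IsScalarTower R A M] [AddCommGroup N] [Module A N] [Module R N] [IsScalarTower R A N]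
    (hM : RelDomDimGE R A t M) (hN : RelDomDimGE R A t N) : RelDomDimGE R A t (M × N) :=
  .of_extension (LinearMap.inl A M N) (LinearMap.snd A M N)
    ⟨LinearMap.fst R M N, LinearMap.inr R M N, by simp, by simp, by simp, by simp⟩ hM hN

lemma LinearEquiv.isSummandOf {M W : Type} [AddCommGroup M] [Module A M] [AddCommGroup W]
    [Module A W] (e : M ≃ₗ[A] W) : IsSummandOf A M W :=
  ⟨e.toLinearMap, e.symm.toLinearMap, LinearMap.ext e.symm_apply_apply⟩

lemma RelDomDimGE.pi {t : ℕ} {κ : Type} [Finite κ] :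
    ∀ (M : κ → Type) [∀ k, AddCommGroup (M k)] [∀ k, Module A (M k)] [∀ k, Module R (M k)]
      [∀ k, IsScalarTower R A (M k)],
      (∀ k, RelDomDimGE R A t (M k)) → RelDomDimGE R A t (∀ k, M k) := by
  induction κ using Finite.induction_empty_option with
  | of_equiv e ih =>
    intro M _ _ _ _ hM
    exact (ih (fun a => M (e a)) fun a => hM (e a)).of_isSummandOf
      (LinearEquiv.piCongrLeft A M e).symm.isSummandOf
  | h_empty =>
    intro M _ _ _ _ _
    exact relDomDimGE_of_subsingleton t _
  | h_option ih =>
    intro M _ _ _ _ hM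
    exact ((hM none).prod (ih (fun a => M (some a)) fun a => hM (some a))).of_isSummandOf
      (LinearEquiv.piOptionEquivProd A).isSummandOf

/-- Filtered modules inherit lower bounds on the relative dominant dimension from `R`-projective
subquotients. -/
lemma RelDomDimGE.of_hasFilt {t : ℕ} {Θ : ModPred A}
    (hΘ : ∀ (Q : Type) [AddCommGroup Q] [Module A Q] [Module R Q] [IsScalarTower R A Q],
      Θ Q → RelDomDimGE R A t Q ∧ Module.Projective R Q)
    {M : Type} [AddCommGroup M] [Module A M] (hM : HasFilt A Θ M) :
    ∀ [Module R M] [IsScalarTower R A M], RelDomDimGE R A t M ∧ Module.Projective R M := by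
  induction hM with
  | of_subsingleton M h =>
    intro _ _
    exact ⟨relDomDimGE_of_subsingleton t M, inferInstance⟩
  | step K M Q i p hi hp hex hQ hK ih =>
    intro _ _
    let _ : Module R K := Module.compHom K (algebraMap R A)
    let _ : Module R Q := Module.compHom Q (algebraMap R A)
    have : IsScalarTower R A K := .of_algebraMap_smul fun _ _ => rfl
    have : IsScalarTower R A Q := .of_algebraMap_smul fun _ _ => rfl
    obtain ⟨hQt, hQp⟩ := hΘ Q hQ
    obtain ⟨hKt, hKp⟩ := ih
    obtain ⟨σ, hσ⟩ := Module.projective_lifting_property (p.restrictScalars R) LinearMap.id hp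
    have hS := isRelSES_of_section R i p hi hex σ (LinearMap.congr_fun hσ)
    refine ⟨.of_extension i p hS hKt hQt, ?_⟩
    obtain ⟨ρ, σ, hρ, hσ, h0, hsum⟩ := hS
    exact Module.Projective.of_split (ρ.prod (p.restrictScalars R))
      ((i.restrictScalars R).coprod σ) (LinearMap.ext hsum)

lemma IsSummandOf.projective {M W : Type} [AddCommGroup M] [Module A M] [Module R M]
    [IsScalarTower R A M] [AddCommGroup W] [Module A W] [Module R W] [IsScalarTower R A W]
    [Module.Projective R W] (h : IsSummandOf A M W) : Module.Projective R M := by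
  obtain ⟨i, r, hri⟩ := h
  exact Module.Projective.of_split (i.restrictScalars R) (r.restrictScalars R)
    (LinearMap.ext fun x => LinearMap.congr_fun hri x)

lemma SplitQH.relDomDimGE_of_isSummandOf (Q : SplitQH R A) {t n : ℕ} {l : Q.Λ}
    (hl : RelDomDimGE R A t (Q.Δ l)) {X : Type} [AddCommGroup X] [Module A X] [Module R X]
    [IsScalarTower R A X] (h : IsSummandOf A X (Fin n → Q.Δ l)) :
    RelDomDimGE R A t X ∧ Module.Projective R X := by
  have := (Q.rproj l).2
  have : Module.Projective R (Fin n → Q.Δ l) :=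
    .of_equiv (DFinsupp.linearEquivFunOnFintype (R := R) (M := fun _ : Fin n => Q.Δ l))
  exact ⟨(RelDomDimGE.pi (fun _ : Fin n => Q.Δ l) fun _ => hl).of_isSummandOf h, h.projective⟩

lemma SplitQH.relDomDimGE_of_hasFilt (Q : SplitQH R A) {t : ℕ}
    (hΔ : ∀ l, RelDomDimGE R A t (Q.Δ l)) {M : Type} [AddCommGroup M] [Module A M]
    [Module R M] [IsScalarTower R A M] (hM : HasFilt A (stdClass R A Q) M) :
    RelDomDimGE R A t M :=
  (RelDomDimGE.of_hasFilt (fun _ _ _ _ _ ⟨l, _, h⟩ =>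
    Q.relDomDimGE_of_isSummandOf (hΔ l) h) hM).1

end RelativeDominantDimension

/-- Let `(A, {Δ(λ)})` be a split quasi-hereditary algebra over a
commutative Noetherian ring `R`, `(A, P, V)` an RQF3 algebra, and `T = ⨁ T(λ)` a
characteristic tilting module of `A` (each `T(λ)` lies in `𝓕(Δ̃)` and admits an exact
sequence `0 → Δ(λ) → T(λ) → X(λ) → 0` with `X(λ) ∈ 𝓕(Δ̃_{μ<λ})`).  Then
`domdim_{(A,R)} T = inf { domdim_{(A,R)} Δ(λ) : λ } = inf { domdim_{(A,R)} M : M ∈ 𝓕(Δ̃) }`,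
formulated via the `≥ t` predicates for every `t`. -/
theorem relDomDim_tilting_eq_inf
    (R : Type) [CommRing R] [IsNoetherianRing R]
    (A : Type) [Ring A] [Algebra R A] [Module.Finite R A] [Module.Projective R A]
    (Q : SplitQH R A)
    (P : Type) [AddCommGroup P] [Module A P] [Module R P] [IsScalarTower R A P]
    (hP : Module.Finite A P ∧ Module.Projective A P ∧ IsRelInjective R A P ∧
      IsRelStronglyFaithful R A P)
    (V : Type) [AddCommGroup V] [Module Aᵐᵒᵖ V] [Module R V] [IsScalarTower R Aᵐᵒᵖ V]
    (hV : Module.Finite Aᵐᵒᵖ V ∧ Module.Projective Aᵐᵒᵖ V ∧ IsRelInjective R Aᵐᵒᵖ V ∧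
      IsRelStronglyFaithful R Aᵐᵒᵖ V)
    -- the characteristic tilting module `T = ⨁ T(λ)`
    (T : Q.Λ → Type) [∀ l, AddCommGroup (T l)] [∀ l, Module A (T l)]
    [∀ l, Module R (T l)] [∀ l, IsScalarTower R A (T l)]
    (hTfin : ∀ l, Module.Finite A (T l))
    (hTgood : ∀ l, HasFilt A (stdClass R A Q) (T l))
    (hTses : ∀ l : Q.Λ, ∃ (ι : Q.Δ l →ₗ[A] T l) (C : ModuleCat A) (p : T l →ₗ[A] C),
      Function.Injective ι ∧ Function.Surjective p ∧ Function.Exact ι p ∧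
        HasFilt A (fun X [AddCommGroup X] [Module A X] =>
          ∃ m, m < l ∧ ∃ n : ℕ, IsSummandOf A X (Fin n → Q.Δ m)) C)
    (t : ℕ) :
    (RelDomDimGE R A t (∀ l, T l) ↔ ∀ l, RelDomDimGE R A t (Q.Δ l)) ∧
    (RelDomDimGE R A t (∀ l, T l) ↔
      ∀ (M : Type) [AddCommGroup M] [Module A M] [Module R M] [IsScalarTower R A M],
        HasFilt A (stdClass R A Q) M → RelDomDimGE R A t M) := by
  have hΔ : RelDomDimGE R A t (∀ l, T l) → ∀ l, RelDomDimGE R A t (Q.Δ l) := by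
    intro hT l
    induction l using WellFoundedLT.induction with
    | ind l ih =>
      cases t with
      | zero => exact relDomDimGE_zero _
      | succ t =>
        classical
        have hTl : RelDomDimGE R A (t + 1) (T l) := hT.of_isSummandOf
          ⟨LinearMap.single A T l, LinearMap.proj l, LinearMap.ext fun x => by simp⟩
        obtain ⟨ι, C, p, hι, hp, hex, hC⟩ := hTses l
        let _ : Module R C := Module.compHom C (algebraMap R A)
        have : IsScalarTower R A C := .of_algebraMap_smul fun _ _ => rfl
        obtain ⟨hCt, hCp⟩ := RelDomDimGE.of_hasFilt (R := R) (t := t + 1)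
          (fun _ _ _ _ _ ⟨m, hm, _, h⟩ => Q.relDomDimGE_of_isSummandOf (ih m hm) h) hC
        obtain ⟨σ, hσ⟩ :=
          Module.projective_lifting_property (p.restrictScalars R) LinearMap.id hp
        exact .of_kernel ι p (isRelSES_of_section R ι p hι hex σ (LinearMap.congr_fun hσ))
          hTl hCt.of_succ
  refine ⟨⟨hΔ, fun h => .pi T fun l => Q.relDomDimGE_of_hasFilt h (hTgood l)⟩,
    fun hT M _ _ _ _ hM => Q.relDomDimGE_of_hasFilt (hΔ hT) hM,
    fun h => .pi T fun l => h (T l) (hTgood l)⟩
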